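/- For every α ∈ (0, π/2), one has 16/(π − 2α)³ + 4/α³ + 4/(α − π)³ − 4·cos(α)/sin³(α) − 2·sin(α)/cos³(α) > 0. Consequently, the function u(α) = 2/(π − 2α) + 2/α + 2/(α − π) − 2·cot(α) − tan(α) is strictly convex on (0, π/2). -/

import Mathlib

open Real

lemma nonneg_of_hasDerivAt_of_zero {f f' : ℝ → ℝ} (hf : ∀ x, HasDerivAt f (f' x) x)
    (h0 : f 0 = 0) (hf' : ∀ x, 0 ≤ x → 0 ≤ f' x) {x : ℝ} (hx : 0 ≤ x) : 0 ≤ f x := by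
  have hmono : MonotoneOn f (Set.Ici 0) := by
    refine monotoneOn_of_deriv_nonneg (convex_Ici 0)
      (fun y _ => (hf y).continuousAt.continuousWithinAt)
      (fun y _ => (hf y).differentiableAt.differentiableWithinAt) fun y hy => ?_
    rw [interior_Ici] at hy
    rw [(hf y).deriv]
    exact hf' y (le_of_lt hy)
  simpa [h0] using hmono Set.self_mem_Ici hx hx

lemma cos_le_taylor_four {x : ℝ} (hx : 0 ≤ x) : cos x ≤ 1 - x ^ 2 / 2 + x ^ 4 / 24 := by
  have h := nonneg_of_hasDerivAt_of_zero
    (f := fun x => 1 - x ^ 2 / 2 + x ^ 4 / 24 - cos x) (f' := fun x => sin x - (x - x ^ 3 / 6))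
    (fun x => by
      refine HasDerivAt.congr_deriv (((((hasDerivAt_pow 2 x).div_const 2).const_sub 1).add
        ((hasDerivAt_pow 4 x).div_const 24)).sub (hasDerivAt_cos x)) ?_
      push_cast
      ring)
    (by simp) (fun x hx => sub_nonneg.2 (sin_ge_sub_cube hx)) hx
  exact sub_nonneg.1 h

lemma sin_le_taylor_five {x : ℝ} (hx : 0 ≤ x) : sin x ≤ x - x ^ 3 / 6 + x ^ 5 / 120 := by
  have h := nonneg_of_hasDerivAt_of_zero
    (f := fun x => x - x ^ 3 / 6 + x ^ 5 / 120 - sin x)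
    (f' := fun x => 1 - x ^ 2 / 2 + x ^ 4 / 24 - cos x)
    (fun x => by
      refine HasDerivAt.congr_deriv ((((hasDerivAt_id' x).sub ((hasDerivAt_pow 3 x).div_const 6)).add
        ((hasDerivAt_pow 5 x).div_const 120)).sub (hasDerivAt_sin x)) ?_
      push_cast
      ring)
    (by simp) (fun x hx => sub_nonneg.2 (cos_le_taylor_four hx)) hx
  exact sub_nonneg.1 h

lemma taylor_six_le_cos {x : ℝ} (hx : 0 ≤ x) :
    1 - x ^ 2 / 2 + x ^ 4 / 24 - x ^ 6 / 720 ≤ cos x := by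
  have h := nonneg_of_hasDerivAt_of_zero
    (f := fun x => cos x - (1 - x ^ 2 / 2 + x ^ 4 / 24 - x ^ 6 / 720))
    (f' := fun x => x - x ^ 3 / 6 + x ^ 5 / 120 - sin x)
    (fun x => by
      refine HasDerivAt.congr_deriv ((hasDerivAt_cos x).sub
        (((((hasDerivAt_pow 2 x).div_const 2).const_sub 1).add
        ((hasDerivAt_pow 4 x).div_const 24)).sub ((hasDerivAt_pow 6 x).div_const 720))) ?_
      push_cast
      ring)
    (by simp) (fun x hx => sub_nonneg.2 (sin_le_taylor_five hx)) hx
  exact sub_nonneg.1 h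

lemma taylor_seven_le_sin {x : ℝ} (hx : 0 ≤ x) :
    x - x ^ 3 / 6 + x ^ 5 / 120 - x ^ 7 / 5040 ≤ sin x := by
  have h := nonneg_of_hasDerivAt_of_zero
    (f := fun x => sin x - (x - x ^ 3 / 6 + x ^ 5 / 120 - x ^ 7 / 5040))
    (f' := fun x => cos x - (1 - x ^ 2 / 2 + x ^ 4 / 24 - x ^ 6 / 720))
    (fun x => by
      refine HasDerivAt.congr_deriv ((hasDerivAt_sin x).sub ((((hasDerivAt_id' x).sub
        ((hasDerivAt_pow 3 x).div_const 6)).add ((hasDerivAt_pow 5 x).div_const 120)).sub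
        ((hasDerivAt_pow 7 x).div_const 5040))) ?_
      push_cast
      ring)
    (by simp) (fun x hx => sub_nonneg.2 (taylor_six_le_cos hx)) hx
  exact sub_nonneg.1 h

lemma cos_le_taylor_eight {x : ℝ} (hx : 0 ≤ x) :
    cos x ≤ 1 - x ^ 2 / 2 + x ^ 4 / 24 - x ^ 6 / 720 + x ^ 8 / 40320 := by
  have h := nonneg_of_hasDerivAt_of_zero
    (f := fun x => 1 - x ^ 2 / 2 + x ^ 4 / 24 - x ^ 6 / 720 + x ^ 8 / 40320 - cos x)
    (f' := fun x => sin x - (x - x ^ 3 / 6 + x ^ 5 / 120 - x ^ 7 / 5040))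
    (fun x => by
      refine HasDerivAt.congr_deriv (((((((hasDerivAt_pow 2 x).div_const 2).const_sub 1).add
        ((hasDerivAt_pow 4 x).div_const 24)).sub ((hasDerivAt_pow 6 x).div_const 720)).add
        ((hasDerivAt_pow 8 x).div_const 40320)).sub (hasDerivAt_cos x)) ?_
      push_cast
      ring)
    (by simp) (fun x hx => sub_nonneg.2 (taylor_seven_le_sin hx)) hx
  exact sub_nonneg.1 h

lemma cos_taylor_le_sin_taylor_cube_mul {z : ℝ} (hz : 0 ≤ z) (hz' : z ≤ 5 / 2) :
    1 - z / 2 + z ^ 2 / 24 - z ^ 3 / 720 + z ^ 4 / 40320 ≤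
      (1 - z / 6 + z ^ 2 / 120 - z ^ 3 / 5040) ^ 3 * (1 - z ^ 2 / 15) := by
  have h₀ : 0 ≤ 4 / 189 - 59 / 9600 * z := by linarith
  have h₂ : 0 ≤ 1529 / 1814400 - 6017 / 84672000 * z := by linarith
  have h₄ : 0 ≤ 2041 / 508032000 - 113 / 725760000 * z := by linarith
  have h₆ : 0 ≤ 2599 / 640120320000 - 1 / 15240960000 * z := by linarith
  have h : 0 ≤ z ^ 3 * ((4 / 189 - 59 / 9600 * z) +
      z ^ 2 * (1529 / 1814400 - 6017 / 84672000 * z) +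
      z ^ 4 * (2041 / 508032000 - 113 / 725760000 * z) +
      z ^ 6 * (2599 / 640120320000 - 1 / 15240960000 * z) + z ^ 8 / 1920360960000) := by
    positivity
  linear_combination h

/-- The truncated Laurent expansion of `cos / sin ^ 3` at `0` is an upper bound. -/
lemma cos_div_sin_cube_le {y : ℝ} (hy : 0 < y) (hy' : y < π / 2) :
    cos y / sin y ^ 3 ≤ 1 / y ^ 3 - y / 15 := by
  have hy2 : y < 1.5708 := by linarith [pi_lt_d4]
  have hz : y ^ 2 ≤ 5 / 2 := by nlinarith
  have hsin : 0 < sin y := sin_pos_of_pos_of_lt_pi hy (by linarith)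
  have hS : 0 ≤ 1 - y ^ 2 / 6 + (y ^ 2) ^ 2 / 120 - (y ^ 2) ^ 3 / 5040 := by
    have : (y ^ 2) ^ 3 ≤ (5 / 2) ^ 3 := by gcongr
    nlinarith [sq_nonneg (y ^ 2)]
  have hpoly := cos_taylor_le_sin_taylor_cube_mul (sq_nonneg y) hz
  have hfac : 0 ≤ 1 - (y ^ 2) ^ 2 / 15 := by nlinarith [sq_nonneg y]
  have hcos := cos_le_taylor_eight hy.le
  have hsin' : y * (1 - y ^ 2 / 6 + (y ^ 2) ^ 2 / 120 - (y ^ 2) ^ 3 / 5040) ≤ sin y := by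
    linarith [taylor_seven_le_sin hy.le]
  have hkey : y ^ 3 * cos y ≤ sin y ^ 3 * (1 - (y ^ 2) ^ 2 / 15) := calc
    y ^ 3 * cos y ≤ y ^ 3 * ((1 - y ^ 2 / 6 + (y ^ 2) ^ 2 / 120 - (y ^ 2) ^ 3 / 5040) ^ 3 *
        (1 - (y ^ 2) ^ 2 / 15)) := by
      gcongr
      linarith
    _ = (y * (1 - y ^ 2 / 6 + (y ^ 2) ^ 2 / 120 - (y ^ 2) ^ 3 / 5040)) ^ 3 *
        (1 - (y ^ 2) ^ 2 / 15) := by ring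
    _ ≤ sin y ^ 3 * (1 - (y ^ 2) ^ 2 / 15) := by gcongr
  have heq : 1 / y ^ 3 - y / 15 = (1 - (y ^ 2) ^ 2 / 15) / y ^ 3 := by
    field_simp
  rw [heq, div_le_div_iff₀ (by positivity) (by positivity)]
  linarith

lemma sin_taylor_mul_lt {z : ℝ} (hz : 0 ≤ z) (hz' : z ≤ 16 / 25) :
    (1 - z / 6 + z ^ 2 / 120) * (2.468 - z) ^ 3 <
      ((2.468 - z) ^ 3 / 30 + 6 * (2.468 - z) + 8 * z) * (1 - z / 2 + z ^ 2 / 25) ^ 3 := by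
  have hw : 0 ≤ 16 / 25 - z := by linarith
  have h : 0 <
      50617860546875 / 3298534883328 * (16 / 25 - z) ^ 9 +
      362487906296875 / 3298534883328 * z * (16 / 25 - z) ^ 8 +
      95458624491425 / 274877906944 * z ^ 2 * (16 / 25 - z) ^ 7 +
      174498666813813 / 274877906944 * z ^ 3 * (16 / 25 - z) ^ 6 +
      253835149472519559 / 343597383680000 * z ^ 4 * (16 / 25 - z) ^ 5 +
      4867918131573096103 / 8589934592000000 * z ^ 5 * (16 / 25 - z) ^ 4 +
      767911191156447011909 / 2684354560000000000 * z ^ 6 * (16 / 25 - z) ^ 3 +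
      736573103864666162051 / 8053063680000000000 * z ^ 7 * (16 / 25 - z) ^ 2 +
      180112303108096920553 / 10737418240000000000 * z ^ 8 * (16 / 25 - z) +
      43220113490924290363 / 32212254720000000000 * z ^ 9 := by
    rcases hz.eq_or_lt with rfl | hz₀
    · norm_num
    · positivity
  linear_combination h

lemma sin_div_cos_cube_lt_of_le {y : ℝ} (hy : 0 < y) (hy' : y ≤ 4 / 5) :
    sin y / cos y ^ 3 < y / 30 + 1 / (π / 2 - y) ^ 3 - 1 / (π / 2 + y) ^ 3 := by
  have hpi := pi_gt_d4
  have hpi' := pi_lt_d4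
  have hz : y ^ 2 ≤ 16 / 25 := by nlinarith
  have hC : 0 < 1 - y ^ 2 / 2 + (y ^ 2) ^ 2 / 25 := by nlinarith [sq_nonneg (y ^ 2)]
  have hcos : 1 - y ^ 2 / 2 + (y ^ 2) ^ 2 / 25 ≤ cos y := by
    have h : 0 ≤ (y ^ 2) ^ 2 * (1 / 600 - y ^ 2 / 720) := by
      have : 0 ≤ 1 / 600 - y ^ 2 / 720 := by linarith
      positivity
    linarith [taylor_six_le_cos hy.le]
  have hsin : sin y ≤ y * (1 - y ^ 2 / 6 + (y ^ 2) ^ 2 / 120) := by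
    linarith [sin_le_taylor_five hy.le]
  have hsub : 0 < π / 2 - y := by linarith
  have hd : 0 < (π / 2) ^ 2 - y ^ 2 := by nlinarith
  have hdD : (π / 2) ^ 2 - y ^ 2 ≤ 2.468 - y ^ 2 := by nlinarith
  have hD : 0 < 2.468 - y ^ 2 := by linarith
  have hnum : 0 ≤ y * (1 - y ^ 2 / 6 + (y ^ 2) ^ 2 / 120) := by
    have : 0 ≤ 1 - y ^ 2 / 6 := by linarith
    positivity
  calc sin y / cos y ^ 3
      ≤ y * (1 - y ^ 2 / 6 + (y ^ 2) ^ 2 / 120) / (1 - y ^ 2 / 2 + (y ^ 2) ^ 2 / 25) ^ 3 := by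
        gcongr
    _ = y * ((1 - y ^ 2 / 6 + (y ^ 2) ^ 2 / 120) / (1 - y ^ 2 / 2 + (y ^ 2) ^ 2 / 25) ^ 3) := by
        ring
    _ < y * (((2.468 - y ^ 2) ^ 3 / 30 + 6 * (2.468 - y ^ 2) + 8 * y ^ 2) /
          (2.468 - y ^ 2) ^ 3) := by
        refine mul_lt_mul_of_pos_left ?_ hy
        rw [div_lt_div_iff₀ (by positivity) (by positivity)]
        exact sin_taylor_mul_lt (sq_nonneg y) hz
    _ = y * (1 / 30 + 6 / (2.468 - y ^ 2) ^ 2 + 8 * y ^ 2 / (2.468 - y ^ 2) ^ 3) := by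
        field_simp
    _ ≤ y * (1 / 30 + 6 / ((π / 2) ^ 2 - y ^ 2) ^ 2 +
          8 * y ^ 2 / ((π / 2) ^ 2 - y ^ 2) ^ 3) := by
        gcongr
    _ = y / 30 + 1 / (π / 2 - y) ^ 3 - 1 / (π / 2 + y) ^ 3 := by
        have hfac : (π / 2) ^ 2 - y ^ 2 = (π / 2 - y) * (π / 2 + y) := by ring
        have hadd : 0 < π / 2 + y := by linarith
        rw [hfac]
        generalize hp : π / 2 - y = p at *
        generalize hq : π / 2 + y = q at *
        obtain rfl : y = (q - p) / 2 := by linarith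
        field_simp
        ring

lemma sin_div_cos_cube_lt {y : ℝ} (hy : 0 < y) (hy' : y < π / 2) :
    sin y / cos y ^ 3 < y / 30 + 1 / (π / 2 - y) ^ 3 - 1 / (π / 2 + y) ^ 3 := by
  rcases le_total y (4 / 5) with h | h
  · exact sin_div_cos_cube_lt_of_le hy h
  have hpi := pi_gt_d4
  have hpi' := pi_lt_d4
  have hL := cos_div_sin_cube_le (y := π / 2 - y) (by linarith) (by linarith)
  rw [cos_pi_div_two_sub, sin_pi_div_two_sub] at hL
  have hpos : 0 < π / 2 + y := by linarith
  have hbound : 1 / (π / 2 + y) ^ 3 < y / 30 + (π / 2 - y) / 15 := by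
    rw [div_lt_iff₀ (by positivity)]
    have h₁ : (2.37 : ℝ) ≤ π / 2 + y := by linarith
    have h₂ : π / 2 + y ≤ 3.1416 := by linarith
    have h₃ : (4.712 - (π / 2 + y)) / 30 ≤ y / 30 + (π / 2 - y) / 15 := by linarith
    have h₄ : 1 < (4.712 - (π / 2 + y)) / 30 * (π / 2 + y) ^ 3 := by
      generalize π / 2 + y = s at *
      nlinarith [mul_nonneg (sub_nonneg.2 h₁) (sub_nonneg.2 h₂),
        mul_nonneg (mul_nonneg (sub_nonneg.2 h₁) (sub_nonneg.2 h₂)) (by linarith : 0 ≤ s),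
        mul_nonneg (mul_nonneg (sub_nonneg.2 h₁) (sub_nonneg.2 h₂)) (sq_nonneg s)]
    exact h₄.trans_le (by gcongr)
  linarith

lemma u_second_deriv_pos {α : ℝ} (hα : α ∈ Set.Ioo (0 : ℝ) (π / 2)) :
    0 < 16 / (π - 2 * α) ^ 3 + 4 / α ^ 3 + 4 / (α - π) ^ 3 -
        4 * cos α / sin α ^ 3 - 2 * sin α / cos α ^ 3 := by
  obtain ⟨h₀, h₁⟩ := hα
  have hy : 0 < π / 2 - α := by linarith
  have hF := cos_div_sin_cube_le hy (by linarith)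
  have hG := sin_div_cos_cube_lt hy (by linarith)
  rw [cos_pi_div_two_sub, sin_pi_div_two_sub] at hF hG
  have e₁ : 16 / (π - 2 * α) ^ 3 = 2 * (1 / (π / 2 - α) ^ 3) := by
    rw [show π - 2 * α = 2 * (π / 2 - α) by ring]
    field_simp
    norm_num
  have e₂ : 4 / (α - π) ^ 3 = -4 * (1 / (π / 2 + (π / 2 - α)) ^ 3) := by
    rw [show α - π = -(π / 2 + (π / 2 - α)) by ring, Odd.neg_pow (by decide), div_neg]
    ring
  rw [sub_sub_cancel] at hG
  rw [e₁, e₂, mul_div_assoc, mul_div_assoc, show 4 / α ^ 3 = 4 * (1 / α ^ 3) by ring]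
  linarith

lemma hasDerivAt_u {α : ℝ} (hα : α ∈ Set.Ioo (0 : ℝ) (π / 2)) :
    HasDerivAt (fun α => 2 / (π - 2 * α) + 2 / α + 2 / (α - π) - 2 * cot α - tan α)
      (4 / (π - 2 * α) ^ 2 - 2 / α ^ 2 - 2 / (α - π) ^ 2 + 2 / sin α ^ 2 - 1 / cos α ^ 2) α := by
  obtain ⟨h₀, h₁⟩ := hα
  have hsin : sin α ≠ 0 := (sin_pos_of_pos_of_lt_pi h₀ (by linarith)).ne'
  have hcos : cos α ≠ 0 := (cos_pos_of_mem_Ioo ⟨by linarith, h₁⟩).ne'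
  have hα₁ : π - 2 * α ≠ 0 := by linarith
  have hα₂ : α - π ≠ 0 := by linarith
  simp only [cot_eq_cos_div_sin]
  have d₁ := (hasDerivAt_const α (2 : ℝ)).div
    (((hasDerivAt_id' α).const_mul 2).const_sub π) hα₁
  have d₂ := (hasDerivAt_const α (2 : ℝ)).div (hasDerivAt_id' α) h₀.ne'
  have d₃ := (hasDerivAt_const α (2 : ℝ)).div ((hasDerivAt_id' α).sub_const π) hα₂
  have d₄ := ((hasDerivAt_cos α).div (hasDerivAt_sin α) hsin).const_mul 2
  refine HasDerivAt.congr_deriv ((((d₁.add d₂).add d₃).sub d₄).sub (hasDerivAt_tan hcos)) ?_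
  have e : -sin α * sin α - cos α * cos α = -1 := by linarith [sin_sq_add_cos_sq α]
  rw [e]
  ring

lemma hasDerivAt_deriv_u {α : ℝ} (hα : α ∈ Set.Ioo (0 : ℝ) (π / 2)) :
    HasDerivAt (fun α => 4 / (π - 2 * α) ^ 2 - 2 / α ^ 2 - 2 / (α - π) ^ 2 + 2 / sin α ^ 2 -
        1 / cos α ^ 2)
      (16 / (π - 2 * α) ^ 3 + 4 / α ^ 3 + 4 / (α - π) ^ 3 -
        4 * cos α / sin α ^ 3 - 2 * sin α / cos α ^ 3) α := by
  obtain ⟨h₀, h₁⟩ := hα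
  have hsin : sin α ≠ 0 := (sin_pos_of_pos_of_lt_pi h₀ (by linarith)).ne'
  have hcos : cos α ≠ 0 := (cos_pos_of_mem_Ioo ⟨by linarith, h₁⟩).ne'
  have hα₁ : π - 2 * α ≠ 0 := by linarith
  have hα₂ : α - π ≠ 0 := by linarith
  have hinv {f : ℝ → ℝ} {f' : ℝ} (c : ℝ) (hf : HasDerivAt f f' α) (hne : f α ≠ 0) :
      HasDerivAt (fun x => c / f x ^ 2) (-2 * c * f' / f α ^ 3) α := by
    refine HasDerivAt.congr_deriv ((hasDerivAt_const α c).div (hf.pow 2) (pow_ne_zero 2 hne)) ?_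
    field_simp
    push_cast
    ring
  have d₁ := hinv 4 (((hasDerivAt_id' α).const_mul 2).const_sub π) hα₁
  have d₂ := hinv 2 (hasDerivAt_id' α) h₀.ne'
  have d₃ := hinv 2 ((hasDerivAt_id' α).sub_const π) hα₂
  have d₄ := hinv 2 (hasDerivAt_sin α) hsin
  have d₅ := hinv 1 (hasDerivAt_cos α) hcos
  refine HasDerivAt.congr_deriv ((((d₁.sub d₂).sub d₃).add d₄).sub d₅) ?_
  ring

/-- The second derivative of `u(α) = 2/(π−2α) + 2/α + 2/(α−π) − 2 cot α − tan α` is positive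
on `(0, π/2)`; consequently `u` is strictly convex on `(0, π/2)`. -/
theorem u_second_deriv_pos_and_strictConvex :
    (∀ α ∈ Set.Ioo (0 : ℝ) (π / 2),
      16 / (π - 2 * α) ^ 3 + 4 / α ^ 3 + 4 / (α - π) ^ 3 -
        4 * Real.cos α / (Real.sin α) ^ 3 - 2 * Real.sin α / (Real.cos α) ^ 3 > 0) ∧
    StrictConvexOn ℝ (Set.Ioo (0 : ℝ) (π / 2))
      (fun α => 2 / (π - 2 * α) + 2 / α + 2 / (α - π) - 2 * Real.cot α - Real.tan α) := by
  refine ⟨fun α hα => u_second_deriv_pos hα, ?_⟩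
  refine strictConvexOn_of_deriv2_pos (convex_Ioo _ _)
    (fun α hα => (hasDerivAt_u hα).continuousAt.continuousWithinAt) fun α hα => ?_
  rw [interior_Ioo] at hα
  have hderiv := Filter.eventuallyEq_of_mem (isOpen_Ioo.mem_nhds hα)
    fun β hβ => (hasDerivAt_u hβ).deriv
  rw [Function.iterate_succ, Function.iterate_one, Function.comp_apply, hderiv.deriv_eq,
    (hasDerivAt_deriv_u hα).deriv]
  exact u_second_deriv_pos hα
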